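/- arXiv:2511.22654 — 3 statements merged into one kernel-verified Lean document; each statement's English description precedes it below -/
import Mathlib

section
/- For every unit vector ψ ∈ ℂⁿ, the time-ordered-correlator value ⟨(|0⟩⊗ψ), C (|0⟩⊗ψ)⟩ equals Σ_{l=1}^{n} |α_l|² cos(θ_l) = Σ_{l=1}^{n} |α_l|² (2λ_l² − 1) = Σ_{l=1}^{n} |α_l|² T_2(λ_l); i.e., the TOC measures the first Fourier harmonic of the phase distribution of the singular values of A. -/
open Matrix Finset

theorem toc_iso {m : Type*} [Fintype m] [DecidableEq m] (M : Matrix m m ℂ) (h : Mᴴ * M = 1)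
    (x : m → ℂ) : star (M *ᵥ x) ⬝ᵥ (M *ᵥ x) = star x ⬝ᵥ x := by
  rw [Matrix.star_mulVec, ← Matrix.dotProduct_mulVec, Matrix.mulVec_mulVec, h, Matrix.one_mulVec]

theorem toc_sq (z : ℂ) : star z * z = ((‖z‖ ^ 2 : ℝ) : ℂ) := by
  have := Complex.conj_mul' z
  push_cast
  exact this

/-- The TOC measures the first Fourier harmonic of the phase distribution of the
singular values of `A`:
`⟨(|0⟩⊗ψ), C (|0⟩⊗ψ)⟩ = Σ_l |α_l|² cos θ_l = Σ_l |α_l|² (2λ_l² − 1) = Σ_l |α_l|² T_2(λ_l)`. -/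
theorem toc_first_harmonic
    (n : ℕ) (hn : 1 ≤ n)
    (Ut : Matrix (Fin 2 × Fin n) (Fin 2 × Fin n) ℂ)
    (hUt : Ut ∈ Matrix.unitaryGroup (Fin 2 × Fin n) ℂ)
    (A : Matrix (Fin n) (Fin n) ℂ)
    (hA : ∀ a b : Fin n, A a b = Ut (0, a) (0, b))
    (ZI : Matrix (Fin 2 × Fin n) (Fin 2 × Fin n) ℂ)
    (hZI : ∀ p q : Fin 2 × Fin n,
      ZI p q = if p = q then (if p.1 = 0 then 1 else -1) else 0)
    (C : Matrix (Fin 2 × Fin n) (Fin 2 × Fin n) ℂ)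
    (hC : C = Utᴴ * ZI * Ut * ZI)
    -- singular value decomposition of `A`
    (ψb φb : Fin n → (Fin n → ℂ))
    (hψb : ∀ l l' : Fin n, star (ψb l) ⬝ᵥ ψb l' = if l = l' then 1 else 0)
    (hφb : ∀ l l' : Fin n, star (φb l) ⬝ᵥ φb l' = if l = l' then 1 else 0)
    (lam θ : Fin n → ℝ)
    (hAφ : ∀ l : Fin n, A *ᵥ φb l = (lam l : ℂ) • ψb l)
    (hAψ : ∀ l : Fin n, Aᴴ *ᵥ ψb l = (lam l : ℂ) • φb l)
    (hlam : ∀ l : Fin n, lam l ∈ Set.Icc (0 : ℝ) 1)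
    (hθ : ∀ l : Fin n, θ l ∈ Set.Icc (0 : ℝ) Real.pi)
    (hlamθ : ∀ l : Fin n, lam l = Real.cos (θ l / 2))
    -- reference unit vector `ψ` and its overlaps `α_l`
    (ψ : Fin n → ℂ) (hψ : star ψ ⬝ᵥ ψ = 1)
    (v : Fin 2 × Fin n → ℂ)
    (hv : ∀ p : Fin 2 × Fin n, v p = if p.1 = 0 then ψ p.2 else 0)
    (α : Fin n → ℂ) (hα : ∀ l : Fin n, α l = star (φb l) ⬝ᵥ ψ)
    :
    star v ⬝ᵥ (C *ᵥ v)
      = ((∑ l : Fin n, ‖α l‖ ^ 2 * Real.cos (θ l) : ℝ) : ℂ)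
    ∧ star v ⬝ᵥ (C *ᵥ v)
      = ((∑ l : Fin n, ‖α l‖ ^ 2 * (2 * lam l ^ 2 - 1) : ℝ) : ℂ)
    ∧ star v ⬝ᵥ (C *ᵥ v)
      = ((∑ l : Fin n, ‖α l‖ ^ 2 *
          (Polynomial.Chebyshev.T ℝ 2).eval (lam l) : ℝ) : ℂ) := by
  have hU : Utᴴ * Ut = 1 := Matrix.mem_unitaryGroup_iff'.mp hUt
  have hZ : ∀ (x : Fin 2 × Fin n → ℂ) p, (ZI *ᵥ x) p = (if p.1 = 0 then 1 else -1) * x p := by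
    intro x p
    simp only [Matrix.mulVec, dotProduct, hZI, ite_mul, zero_mul]
    simp
  have hZv : ZI *ᵥ v = v := by
    funext p
    rw [hZ, hv]
    split_ifs <;> simp
  have hw0 : ∀ a, (Ut *ᵥ v) (0, a) = (A *ᵥ ψ) a := by
    intro a
    simp [Matrix.mulVec, dotProduct, Fintype.sum_prod_type, hv, hA]
  have hvv : star v ⬝ᵥ v = 1 := by
    rw [← hψ]
    simp [dotProduct, Fintype.sum_prod_type, hv]
  have hww := toc_iso Ut hU v
  rw [hvv] at hww
  have hCv : star v ⬝ᵥ (C *ᵥ v) = star (Ut *ᵥ v) ⬝ᵥ (ZI *ᵥ (Ut *ᵥ v)) := by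
    rw [hC, ← Matrix.mulVec_mulVec, hZv, ← Matrix.mulVec_mulVec, ← Matrix.mulVec_mulVec,
      Matrix.star_mulVec, ← Matrix.dotProduct_mulVec]
  have h1 : star v ⬝ᵥ (C *ᵥ v) = 2 * (star (A *ᵥ ψ) ⬝ᵥ (A *ᵥ ψ)) - 1 := by
    rw [hCv]
    simp only [dotProduct, hZ, Fintype.sum_prod_type, Fin.sum_univ_two, Pi.star_apply, hw0]
      at hww ⊢
    simp only [if_true, one_mul, Fin.isValue, one_ne_zero, if_false, neg_mul, mul_neg,
      Finset.sum_neg_distrib]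
    linear_combination -hww
  set Φ : Matrix (Fin n) (Fin n) ℂ := Matrix.of fun a l => φb l a with hΦ
  set Ψ : Matrix (Fin n) (Fin n) ℂ := Matrix.of fun a l => ψb l a with hΨ
  have hΦ1 : Φᴴ * Φ = 1 := by
    ext l l'
    rw [Matrix.one_apply, ← hφb]
    simp [Matrix.mul_apply, dotProduct, hΦ]
  have hΨ1 : Ψᴴ * Ψ = 1 := by
    ext l l'
    rw [Matrix.one_apply, ← hψb]
    simp [Matrix.mul_apply, dotProduct, hΨ]
  have hΦ2 : Φ * Φᴴ = 1 := mul_eq_one_comm.mp hΦ1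
  have hαΦ : α = Φᴴ *ᵥ ψ := by
    funext l
    rw [hα]
    simp [Matrix.mulVec, dotProduct, hΦ]
  have hψα : ψ = Φ *ᵥ α := by
    rw [hαΦ, Matrix.mulVec_mulVec, hΦ2, Matrix.one_mulVec]
  have hAΦ : A * Φ = Ψ * Matrix.diagonal (fun l => (lam l : ℂ)) := by
    ext a l
    have := congrFun (hAφ l) a
    simp only [Matrix.mulVec, dotProduct, Pi.smul_apply, smul_eq_mul] at this
    rw [Matrix.mul_diagonal, Matrix.mul_apply]
    simp only [hΦ, hΨ, Matrix.of_apply]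
    rw [this, mul_comm]
  have hn1 : (∑ l, ((‖α l‖ ^ 2 : ℝ) : ℂ)) = 1 := by
    rw [← hψ, hψα, toc_iso Φ hΦ1]
    simp only [dotProduct, Pi.star_apply, toc_sq]
  have hn2 : star (A *ᵥ ψ) ⬝ᵥ (A *ᵥ ψ) = ∑ l, ((‖α l‖ ^ 2 * lam l ^ 2 : ℝ) : ℂ) := by
    rw [hψα, Matrix.mulVec_mulVec, hAΦ, ← Matrix.mulVec_mulVec, toc_iso Ψ hΨ1]
    simp only [dotProduct, Pi.star_apply, toc_sq, Matrix.mulVec_diagonal]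
    refine Finset.sum_congr rfl fun l _ => ?_
    rw [norm_mul, Complex.norm_real, mul_pow, Real.norm_eq_abs, sq_abs, mul_comm]
  have main : star v ⬝ᵥ (C *ᵥ v)
      = ((∑ l : Fin n, ‖α l‖ ^ 2 * (2 * lam l ^ 2 - 1) : ℝ) : ℂ) := by
    rw [h1, hn2, ← hn1, Finset.mul_sum, ← Finset.sum_sub_distrib, Complex.ofReal_sum]
    refine Finset.sum_congr rfl fun l _ => ?_
    push_cast
    ring
  refine ⟨?_, main, ?_⟩
  · rw [main]
    congr 1
    refine Finset.sum_congr rfl fun l _ => ?_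
    rw [hlamθ, ← Real.cos_two_mul]
    congr 2
    ring
  · rw [main]
    congr 1
    refine Finset.sum_congr rfl fun l _ => ?_
    simp [Polynomial.Chebyshev.T_two]
end

section
/- Suppose every singular value λ_l of A lies in {0,1} (the bimodal spectrum occurring outside the causal cone). Then for every integer k ≥ 1 and every unit vector ψ ∈ ℂⁿ, ⟨(|0⟩⊗ψ), C^{2k} (|0⟩⊗ψ)⟩ = 1; i.e., all higher-order OTOCs equal 1 exactly when the truncated propagator has a bimodal {0,1} singular spectrum, because T_{4k}(0) = T_{4k}(1) = 1. -/
open Matrix Finset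

open scoped ComplexOrder in
/-- Two Hermitian idempotents whose compression `P * Q * P` is idempotent commute. -/
theorem proj_commute_aux {m : Type*} [Fintype m] [DecidableEq m] (P Q : Matrix m m ℂ)
    (hP : Pᴴ = P) (hQ : Qᴴ = Q) (hPP : P * P = P) (hQQ : Q * Q = Q)
    (h : P * Q * P * (P * Q * P) = P * Q * P) : P * Q = Q * P := by
  have h' : P * Q * P * Q * P = P * Q * P := by
    calc P * Q * P * Q * P = P * Q * (P * P) * Q * P := by rw [hPP]
      _ = P * Q * P * (P * Q * P) := by noncomm_ring
      _ = _ := h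
  have hX : (Q * P - P * Q * P)ᴴ * (Q * P - P * Q * P) = 0 := by
    simp only [conjTranspose_sub, conjTranspose_mul, hP, hQ]
    calc (P * Q - P * (Q * P)) * (Q * P - P * Q * P)
        = P * (Q * Q) * P - P * Q * P * Q * P - P * Q * P * Q * P
          + P * Q * (P * P) * Q * P := by noncomm_ring
      _ = 0 := by rw [hQQ, hPP, h']; simp
  have hX0 := sub_eq_zero.mp (conjTranspose_mul_self_eq_zero.mp hX)
  have h2 := congrArg conjTranspose hX0
  simp only [conjTranspose_mul, hP, hQ] at h2
  exact h2.trans ((Matrix.mul_assoc P Q P).symm.trans hX0.symm)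

/-- If every singular value of `A` lies in `{0,1}` (the bimodal spectrum outside
the causal cone), then all higher-order OTOCs equal `1`:
`⟨(|0⟩⊗ψ), C^{2k} (|0⟩⊗ψ)⟩ = 1` for every `k ≥ 1`, because `T_{4k}(0) = T_{4k}(1) = 1`. -/
theorem otoc_bimodal_equals_one
    (n : ℕ) (hn : 1 ≤ n)
    (Ut : Matrix (Fin 2 × Fin n) (Fin 2 × Fin n) ℂ)
    (hUt : Ut ∈ Matrix.unitaryGroup (Fin 2 × Fin n) ℂ)
    (A : Matrix (Fin n) (Fin n) ℂ)
    (hA : ∀ a b : Fin n, A a b = Ut (0, a) (0, b))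
    (ZI : Matrix (Fin 2 × Fin n) (Fin 2 × Fin n) ℂ)
    (hZI : ∀ p q : Fin 2 × Fin n,
      ZI p q = if p = q then (if p.1 = 0 then 1 else -1) else 0)
    (C : Matrix (Fin 2 × Fin n) (Fin 2 × Fin n) ℂ)
    (hC : C = Utᴴ * ZI * Ut * ZI)
    -- singular value decomposition of `A`
    (ψb φb : Fin n → (Fin n → ℂ))
    (hψb : ∀ l l' : Fin n, star (ψb l) ⬝ᵥ ψb l' = if l = l' then 1 else 0)
    (hφb : ∀ l l' : Fin n, star (φb l) ⬝ᵥ φb l' = if l = l' then 1 else 0)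
    (lam : Fin n → ℝ)
    (hAφ : ∀ l : Fin n, A *ᵥ φb l = (lam l : ℂ) • ψb l)
    (hAψ : ∀ l : Fin n, Aᴴ *ᵥ ψb l = (lam l : ℂ) • φb l)
    -- bimodal singular spectrum
    (hbimodal : ∀ l : Fin n, lam l = 0 ∨ lam l = 1)
    -- reference unit vector
    (ψ : Fin n → ℂ) (hψ : star ψ ⬝ᵥ ψ = 1)
    (v : Fin 2 × Fin n → ℂ)
    (hv : ∀ p : Fin 2 × Fin n, v p = if p.1 = 0 then ψ p.2 else 0)
    (k : ℕ) (hk : 1 ≤ k) :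
    star v ⬝ᵥ ((C ^ (2 * k)) *ᵥ v) = 1 := by
  have hUU : Ut * Utᴴ = 1 := by
    simpa [star_eq_conjTranspose] using (mem_unitaryGroup_iff.mp hUt)
  have hUU' : Utᴴ * Ut = 1 := mul_eq_one_comm.mp hUU
  -- `AᴴA` is idempotent
  have hM : Aᴴ * A * (Aᴴ * A) = Aᴴ * A := by
    let F : Matrix (Fin n) (Fin n) ℂ := fun a l => φb l a
    have hF : Fᴴ * F = 1 := by
      ext l l'
      rw [Matrix.one_apply, ← hφb l l']
      rfl
    have hF' : F * Fᴴ = 1 := mul_eq_one_comm.mp hF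
    have hMφ : ∀ l, (Aᴴ * A * (Aᴴ * A)) *ᵥ φb l = (Aᴴ * A) *ᵥ φb l := by
      intro l
      rcases hbimodal l with h | h <;>
        simp [← mulVec_mulVec, hAφ, hAψ, h, mulVec_smul]
    have hMF : Aᴴ * A * (Aᴴ * A) * F = Aᴴ * A * F := by
      ext a l
      exact congrFun (hMφ l) a
    calc Aᴴ * A * (Aᴴ * A) = Aᴴ * A * (Aᴴ * A) * F * Fᴴ := by
          rw [Matrix.mul_assoc _ F, hF', Matrix.mul_one]
      _ = Aᴴ * A := by rw [hMF, Matrix.mul_assoc _ F, hF', Matrix.mul_one]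
  obtain ⟨E, hEa⟩ : ∃ E : Matrix (Fin n) (Fin 2 × Fin n) ℂ,
      ∀ a q, E a q = if q = (0, a) then 1 else 0 :=
    ⟨fun a q => if q = (0, a) then 1 else 0, fun _ _ => rfl⟩
  have hE : E * Eᴴ = 1 := by
    ext a b
    simp [hEa, Matrix.mul_apply, Matrix.one_apply, eq_comm]
  have hAE : A = E * Ut * Eᴴ := by
    ext a b
    simp [hEa, Matrix.mul_apply, hA]
  have hZE : ZI = Eᴴ * E + Eᴴ * E - 1 := by
    ext ⟨i, a⟩ ⟨j, b⟩
    rw [hZI]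
    fin_cases i <;> fin_cases j <;>
      simp [hEa, Matrix.mul_apply, Matrix.one_apply]
    by_cases h : a = b
    · simp [h]
    · simp [h, Ne.symm h]
  obtain ⟨P, hPd⟩ : ∃ P, P = Eᴴ * E := ⟨_, rfl⟩
  obtain ⟨Q, hQd⟩ : ∃ Q, Q = Utᴴ * P * Ut := ⟨_, rfl⟩
  have hP : Pᴴ = P := by simp [hPd]
  have hQ : Qᴴ = Q := by simp [hQd, hP, Matrix.mul_assoc]
  have hPP : P * P = P := by
    rw [hPd, Matrix.mul_assoc, ← Matrix.mul_assoc E, hE, Matrix.one_mul]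
  have hQQ : Q * Q = Q := by
    calc Q * Q = Utᴴ * P * (Ut * Utᴴ) * P * Ut := by rw [hQd]; noncomm_ring
      _ = Utᴴ * (P * P) * Ut := by rw [hUU]; noncomm_ring
      _ = Q := by rw [hPP, hQd]
  have hPQP : P * Q * P = Eᴴ * (Aᴴ * A) * E := by
    rw [hQd, hPd, hAE]
    simp only [conjTranspose_mul, conjTranspose_conjTranspose, Matrix.mul_assoc]
  have hcomp : P * Q * P * (P * Q * P) = P * Q * P := by
    rw [hPQP]
    calc Eᴴ * (Aᴴ * A) * E * (Eᴴ * (Aᴴ * A) * E)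
        = Eᴴ * (Aᴴ * A) * (E * Eᴴ) * (Aᴴ * A) * E := by simp only [Matrix.mul_assoc]
      _ = Eᴴ * (Aᴴ * A * (Aᴴ * A)) * E := by
          rw [hE, Matrix.mul_one]; simp only [Matrix.mul_assoc]
      _ = _ := by rw [hM]
  have hc := proj_commute_aux P Q hP hQ hPP hQQ hcomp
  have hCW : C = (Q + Q - 1) * (P + P - 1) := by
    have : Q + Q - 1 = Utᴴ * (P + P - 1) * Ut := by
      rw [Matrix.mul_sub, Matrix.sub_mul, Matrix.mul_one, hUU', Matrix.mul_add, Matrix.add_mul,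
        ← hQd]
    rw [this, hC, hZE, ← hPd]
  have hcc : (P + P - 1) * (Q + Q - 1) = (Q + Q - 1) * (P + P - 1) := by
    simp only [Matrix.mul_sub, Matrix.sub_mul, Matrix.mul_add, Matrix.add_mul, hc,
      Matrix.one_mul, Matrix.mul_one]
    abel
  have hsq : ∀ R : Matrix (Fin 2 × Fin n) (Fin 2 × Fin n) ℂ, R * R = R →
      (R + R - 1) * (R + R - 1) = 1 := by
    intro R hR
    simp only [Matrix.mul_sub, Matrix.sub_mul, Matrix.mul_add, Matrix.add_mul, hR,
      Matrix.one_mul, Matrix.mul_one]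
    abel
  have hC2 : C ^ 2 = 1 := by
    rw [hCW, pow_two, Matrix.mul_assoc, ← Matrix.mul_assoc (P + P - 1), hcc,
      Matrix.mul_assoc, hsq P hPP, Matrix.mul_one, hsq Q hQQ]
  rw [pow_mul, hC2, one_pow, Matrix.one_mulVec, ← hψ]
  simp [dotProduct, Fintype.sum_prod_type, hv]
end

section
/- Let d ≥ 1 and let f be a real polynomial of even parity (f(−x) = f(x)) with deg f ≤ 2d and |f(x)| ≤ 1 for all x ∈ [−1,1] (the standard QSP parity and boundedness constraints). Then there exist real phases β_0, α_1, β_1, …, α_d, β_d such that the single-qubit QSP product M(θ) := e^{−iβ_0 Z} · Π_{r=1}^{d} [ e^{i(θ/2)Y} e^{−iα_r Z} e^{−i(θ/2)Y} e^{−iβ_r Z} ] satisfies Re⟨0|M(θ)|0⟩ = f(cos(θ/2)) for all θ ∈ ℝ. (Achievability of arbitrary admissible degree-2d polynomial filters by the depth-d QSP-OTOC phase sequence.) -/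
open Matrix Polynomial

/-- The Pauli matrix `Y`. -/
noncomputable def pauliY : Matrix (Fin 2) (Fin 2) ℂ :=
  !![0, -Complex.I; Complex.I, 0]

/-- `e^{−i(θ/2)Y} = cos(θ/2)·I − i sin(θ/2)·Y`. -/
noncomputable def Ry (θ : ℝ) : Matrix (Fin 2) (Fin 2) ℂ :=
  (Real.cos (θ / 2) : ℂ) • (1 : Matrix (Fin 2) (Fin 2) ℂ)
    - (Complex.I * (Real.sin (θ / 2) : ℂ)) • pauliY

/-- `e^{−iαZ} = diag(e^{−iα}, e^{iα})`. -/
noncomputable def Rz (α : ℝ) : Matrix (Fin 2) (Fin 2) ℂ :=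
  !![Complex.exp (-(α : ℂ) * Complex.I), 0; 0, Complex.exp ((α : ℂ) * Complex.I)]

/-- The ordered product `term d * term (d-1) * ⋯ * term 1`
(the factor with `r = 1` rightmost, `r` increasing from right to left). -/
noncomputable def qspProd (term : ℕ → Matrix (Fin 2) (Fin 2) ℂ) :
    ℕ → Matrix (Fin 2) (Fin 2) ℂ
  | 0 => 1
  | d + 1 => term (d + 1) * qspProd term d


/-- conjugate polynomial -/
noncomputable abbrev cj (P : ℂ[X]) : ℂ[X] := P.map (starRingEnd ℂ)

structure Good (n : ℕ) (P Q : ℂ[X]) : Prop where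
  hP : ∀ k, P.coeff k ≠ 0 → k ≤ n ∧ (k + n) % 2 = 0
  hQ : ∀ k, Q.coeff k ≠ 0 → k < n ∧ (k + n) % 2 = 1
  hU : P * cj P + (1 - X ^ 2) * (Q * cj Q) = 1

noncomputable def Uv (P Q : ℂ[X]) (θ : ℝ) : Matrix (Fin 2) (Fin 2) ℂ :=
  !![P.eval (Real.cos (θ / 2) : ℂ), -((Real.sin (θ / 2) : ℝ) : ℂ) * Q.eval (Real.cos (θ / 2) : ℂ);
     ((Real.sin (θ / 2) : ℝ) : ℂ) * starRingEnd ℂ (Q.eval (Real.cos (θ / 2) : ℂ)),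
     starRingEnd ℂ (P.eval (Real.cos (θ / 2) : ℂ))]

noncomputable def Rs (σ : ℝ) (θ : ℝ) : Matrix (Fin 2) (Fin 2) ℂ :=
  !![(Real.cos (θ / 2) : ℂ), -(σ : ℂ) * (Real.sin (θ / 2) : ℂ);
     (σ : ℂ) * (Real.sin (θ / 2) : ℂ), (Real.cos (θ / 2) : ℂ)]

lemma Ry_eq (θ : ℝ) : Ry θ = Rs 1 θ := by
  have hI := Complex.I_mul_I
  ext i j
  fin_cases i <;> fin_cases j <;> simp [Ry, Rs, pauliY]
  · linear_combination (Complex.sin ((θ : ℂ) / 2)) * hI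
  · linear_combination (-Complex.sin ((θ : ℂ) / 2)) * hI

lemma RyH_eq (θ : ℝ) : (Ry θ)ᴴ = Rs (-1) θ := by
  rw [Ry_eq]
  ext i j
  fin_cases i <;> fin_cases j <;>
    simp [Rs, Matrix.conjTranspose_apply, -Complex.ofReal_cos, -Complex.ofReal_sin,
      -Complex.ofReal_ofNat, -Complex.ofReal_div]

lemma phase_exists (p q : ℂ) (h : ‖p‖ = ‖q‖) :
    ∃ φ : ℝ, Complex.exp (φ * Complex.I) * p = Complex.exp (-(φ : ℂ) * Complex.I) * q := by
  by_cases hp : p = 0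
  · have : q = 0 := by rw [← norm_eq_zero, ← h, hp, norm_zero]
    exact ⟨0, by simp [hp, this]⟩
  · refine ⟨(q / p).arg / 2, ?_⟩
    have hn : ‖q / p‖ = 1 := by
      rw [norm_div, h, div_self]; rw [← h]; exact norm_ne_zero_iff.mpr hp
    have h1 := Complex.norm_mul_exp_arg_mul_I (q / p)
    rw [hn] at h1
    have h2 : Complex.exp ((((q / p).arg / 2 : ℝ) : ℂ) * Complex.I) *
        Complex.exp ((((q / p).arg / 2 : ℝ) : ℂ) * Complex.I) = q / p := by
      rw [← Complex.exp_add]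
      rw [Complex.ofReal_one, one_mul] at h1
      refine Eq.trans ?_ h1
      congr 1
      push_cast
      ring
    have h3 : Complex.exp (-(((q / p).arg / 2 : ℝ) : ℂ) * Complex.I) *
        Complex.exp ((((q / p).arg / 2 : ℝ) : ℂ) * Complex.I) = 1 := by
      rw [← Complex.exp_add]; simp
    have h4 : q = (q / p) * p := by field_simp
    generalize Complex.exp ((((q / p).arg / 2 : ℝ) : ℂ) * Complex.I) = e at *
    generalize Complex.exp (-(((q / p).arg / 2 : ℝ) : ℂ) * Complex.I) = e' at *
    rw [← h2] at h4
    linear_combination (-e') * h4 - e * p * h3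

lemma lead_norm (n : ℕ) (P Q : ℂ[X]) (h : Good (n + 1) P Q) :
    ‖P.coeff (n + 1)‖ = ‖Q.coeff n‖ := by
  have dP : P.natDegree ≤ n + 1 := by
    rw [natDegree_le_iff_coeff_eq_zero]; intro k hk
    by_contra hc; have := (h.hP k hc).1; omega
  have dQ : Q.natDegree ≤ n := by
    rw [natDegree_le_iff_coeff_eq_zero]; intro k hk
    by_contra hc; have := (h.hQ k hc).1; omega
  have dP' : (cj P).natDegree ≤ n + 1 := (natDegree_map_le).trans dP
  have dQ' : (cj Q).natDegree ≤ n := (natDegree_map_le).trans dQ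
  have dQQ : (Q * cj Q).natDegree ≤ n + n := natDegree_mul_le_of_le dQ dQ'
  have dX : (1 - X ^ 2 : ℂ[X]).natDegree ≤ 2 := by compute_degree
  have e1 := coeff_mul_add_eq_of_natDegree_le dP dP'
  have e2 := coeff_mul_add_eq_of_natDegree_le dQ dQ'
  have e3 := coeff_mul_add_eq_of_natDegree_le dX dQQ
  have e4 := congrArg (fun p => p.coeff (2 + (n + n))) h.hU
  simp only [coeff_add] at e4
  rw [show n + 1 + (n + 1) = 2 + (n + n) by ring] at e1
  rw [e1, e3, e2] at e4
  have e5 : (1 : ℂ[X]).coeff (2 + (n + n)) = 0 := by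
    rw [coeff_one, if_neg (by omega)]
  have e6 : (1 - X ^ 2 : ℂ[X]).coeff 2 = -1 := by simp [coeff_one]
  rw [e5, e6, coeff_map, coeff_map, Complex.mul_conj, Complex.mul_conj] at e4
  have e7 : Complex.normSq (P.coeff (n+1)) = Complex.normSq (Q.coeff n) := by
    have : (Complex.normSq (P.coeff (n+1)) : ℂ) = Complex.normSq (Q.coeff n) := by
      linear_combination e4
    exact_mod_cast this
  rw [Complex.normSq_eq_norm_sq, Complex.normSq_eq_norm_sq] at e7
  exact (sq_eq_sq₀ (norm_nonneg _) (norm_nonneg _)).mp e7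

lemma cj_eval (P : ℂ[X]) (x : ℝ) : (cj P).eval (x : ℂ) = starRingEnd ℂ (P.eval (x : ℂ)) := by
  have := Polynomial.eval_map_apply (f := starRingEnd ℂ) (p := P) (x : ℂ)
  simpa using this

lemma cj_cj (P : ℂ[X]) : cj (cj P) = P := by
  ext k; simp

lemma conj_e (φ : ℝ) : starRingEnd ℂ (Complex.exp (φ * Complex.I)) =
    Complex.exp (-(φ : ℂ) * Complex.I) := by
  rw [← Complex.exp_conj]; simp

lemma step (n : ℕ) (P Q : ℂ[X]) (h : Good (n + 1) P Q) (σ : ℝ) (hσ : σ * σ = 1) :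
    ∃ (φ : ℝ) (P' Q' : ℂ[X]), Good n P' Q' ∧
      ∀ θ, Uv P Q θ = Rz φ * Rs σ θ * Uv P' Q' θ := by
  have hσ' : (σ : ℂ) * σ = 1 := by exact_mod_cast hσ
  have hs1 : ‖(σ : ℂ)‖ = 1 := by
    have := congrArg norm hσ'
    rw [norm_mul, norm_one] at this
    nlinarith [norm_nonneg (σ : ℂ)]
  obtain ⟨φ, hφ⟩ := phase_exists (P.coeff (n+1)) (σ * starRingEnd ℂ (Q.coeff n))
    (by rw [norm_mul, hs1, one_mul, RCLike.norm_conj]; exact lead_norm n P Q h)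
  have hee : Complex.exp (φ * Complex.I) * Complex.exp (-(φ : ℂ) * Complex.I) = 1 := by
    rw [← Complex.exp_add]; simp
  have hc1 := conj_e φ
  have hc2 : starRingEnd ℂ (Complex.exp (-(φ : ℂ) * Complex.I)) = Complex.exp (φ * Complex.I) := by
    rw [← hc1, Complex.conj_conj]
  have hRz : Rz φ = !![Complex.exp (-(φ : ℂ) * Complex.I), 0; 0, Complex.exp (φ * Complex.I)] := rfl
  generalize Complex.exp (φ * Complex.I) = e at *
  generalize Complex.exp (-(φ : ℂ) * Complex.I) = e' at *
  have zP : ∀ k, ¬ (k ≤ n + 1 ∧ (k + (n + 1)) % 2 = 0) → P.coeff k = 0 := fun k hk => by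
    by_contra hc; exact hk (h.hP k hc)
  have zQ : ∀ k, ¬ (k < n + 1 ∧ (k + (n + 1)) % 2 = 1) → Q.coeff k = 0 := fun k hk => by
    by_contra hc; exact hk (h.hQ k hc)
  refine ⟨φ, C e * (X * P) + C (σ * e') * (cj Q - X ^ 2 * cj Q),
    C e * (X * Q) - C (σ * e') * cj P, ⟨?_, ?_, ?_⟩, ?_⟩
  · intro k
    contrapose!
    intro hk
    simp only [coeff_add, coeff_sub, coeff_C_mul, coeff_X_pow_mul', coeff_map]
    rcases k with _ | _ | k
    · have := hk (by omega)
      rw [zQ 0 (by omega)]; simp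
    · simp only [coeff_X_mul]
      by_cases hn : n = 0
      · subst hn
        rw [zP 0 (by omega), zQ _ (by omega)]; simp
      · have := hk (by omega)
        rw [zP 0 (by omega), zQ _ (by omega)]; simp
    · simp only [coeff_X_mul]
      by_cases hkn : k = n
      · subst hkn
        rw [zQ (k + 1 + 1) (by omega)]
        simp
        linear_combination hφ
      · rw [zP (k+1) (by omega), zQ (k + 1 + 1) (by omega), if_pos (by omega), zQ (k+1+1-2) (by omega)]
        simp
  · intro k
    contrapose!
    intro hk
    simp only [coeff_sub, coeff_C_mul, coeff_map]
    rcases k with _ | k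
    · rw [zP 0 (by omega)]; simp
    · simp only [coeff_X_mul]
      by_cases hkn : k = n
      · subst hkn
        have := congrArg (starRingEnd ℂ) hφ
        simp only [map_mul, hc1, hc2, Complex.conj_conj, Complex.conj_ofReal] at this
        linear_combination (-σ : ℂ) * this - e * Q.coeff k * hσ'
      · rw [zP (k+1) (by omega), zQ k (by omega)]
        simp
  · have hU := h.hU
    simp only [cj, Polynomial.map_add, Polynomial.map_sub, Polynomial.map_mul, Polynomial.map_pow,
      map_C, map_X, map_mul, hc1, hc2, Complex.conj_ofReal] at *
    have := cj_cj P
    have := cj_cj Q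
    simp only [cj] at *
    simp only [*]
    have hC : (C e * C e' : ℂ[X]) = 1 := by rw [← C_mul, hee, C_1]
    have hS : (C (σ : ℂ) * C (σ : ℂ) : ℂ[X]) = 1 := by rw [← C_mul, hσ', C_1]
    generalize (C e : ℂ[X]) = E at *
    generalize (C e' : ℂ[X]) = E' at *
    generalize (C (σ : ℂ) : ℂ[X]) = S at *
    generalize Polynomial.map (starRingEnd ℂ) P = P1 at *
    generalize Polynomial.map (starRingEnd ℂ) Q = Q1 at *
    have key : (E * (X * P) + S * E' * (Q1 - X ^ 2 * Q1)) * (E' * (X * P1) + S * E * (Q - X ^ 2 * Q)) +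
      (1 - X ^ 2) * ((E * (X * Q) - S * E' * P1) * (E' * (X * Q1) - S * E * P)) =
      (E * E') * (X ^ 2 * (P * P1) + (S * S) * (1 - X^2)^2 * (Q * Q1)
        + (1 - X ^ 2) * (X^2 * (Q * Q1) + (S * S) * (P * P1))) := by ring
    rw [key, hC, hS]
    linear_combination hU
  · intro θ
    have hsc : ((Real.sin (θ / 2) : ℝ) : ℂ) ^ 2 + ((Real.cos (θ / 2) : ℝ) : ℂ) ^ 2 = 1 := by
      exact_mod_cast Real.sin_sq_add_cos_sq (θ / 2)
    rw [hRz]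
    simp only [Uv, Rs, eval_add, eval_sub, eval_mul, eval_C, eval_X, eval_pow, cj_eval,
      map_add, map_sub, map_mul, map_pow, Complex.conj_conj, Complex.conj_ofReal, hc1, hc2]
    generalize ((Real.sin (θ / 2) : ℝ) : ℂ) = s at *
    generalize ((Real.cos (θ / 2) : ℝ) : ℂ) = c at *
    generalize starRingEnd ℂ (eval c P) = p1 at *
    generalize starRingEnd ℂ (eval c Q) = q1 at *
    generalize eval c P = p at *
    generalize eval c Q = q at *
    generalize (σ : ℂ) = t at *
    have hs : s ^ 2 = 1 - c ^ 2 := by linear_combination hsc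
    have hs3 : s ^ 3 = s * (1 - c ^ 2) := by rw [← hs]; ring
    ext i j
    fin_cases i <;> fin_cases j <;> simp [Matrix.mul_apply, Fin.sum_univ_two]
    · linear_combination (-(c^2 + t^2*s^2) * p) * hee - s^2 * p * hσ' - p * hsc + t * e'^2 * c * q1 * hsc
    · linear_combination s * q * (c^2 + t^2*(1-c^2)) * hee + s * q * (1-c^2) * hσ'
    · linear_combination -s * q1 * (c^2 + t^2*(1-c^2)) * hee - s * q1 * (1-c^2) * hσ'
    · linear_combination (-(c^2 + t^2*s^2) * p1) * hee - s^2 * p1 * hσ' - p1 * hsc + t * e^2 * c * q * hsc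

lemma qspProd_congr (t t' : ℕ → Matrix (Fin 2) (Fin 2) ℂ) (d : ℕ)
    (h : ∀ k, 1 ≤ k → k ≤ d → t k = t' k) : qspProd t d = qspProd t' d := by
  induction d with
  | zero => simp only [qspProd]
  | succ d ih =>
    rw [qspProd, qspProd, ih fun k h1 h2 => h k h1 (by omega), h (d + 1) (by omega) le_rfl]

lemma good_zero (P Q : ℂ[X]) (h : Good 0 P Q) : ∃ b : ℝ, ∀ θ, Uv P Q θ = Rz b := by
  have hQ : Q = 0 := by
    ext k; by_contra hc; have := (h.hQ k hc).1; omega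
  have hP : P = C (P.coeff 0) := by
    ext k
    rcases k with _ | k
    · simp
    · rw [coeff_C_succ]; by_contra hc; have := (h.hP _ hc).1; omega
  have hU := h.hU
  rw [hP, hQ] at hU
  simp only [cj, map_C, zero_mul, mul_zero, add_zero, ← C_mul, ← C_1] at hU
  have hU' := C_injective hU
  rw [Complex.mul_conj, Complex.normSq_eq_norm_sq] at hU'
  have hn : ‖P.coeff 0‖ = 1 := by
    have : ‖P.coeff 0‖ ^ 2 = 1 := by exact_mod_cast hU'
    nlinarith [norm_nonneg (P.coeff 0)]
  have h1 := Complex.norm_mul_exp_arg_mul_I (P.coeff 0)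
  rw [hn, Complex.ofReal_one, one_mul] at h1
  refine ⟨-(P.coeff 0).arg, fun θ => ?_⟩
  have hev : ∀ x, P.eval x = Complex.exp ((P.coeff 0).arg * Complex.I) := by
    intro x; rw [h1, hP]; simp
  have hc := conj_e (P.coeff 0).arg
  simp only [Uv, hev, hQ, hc, Rz]
  simp

lemma qsp_of_good (d : ℕ) : ∀ (P Q : ℂ[X]), Good (2 * d) P Q →
    ∃ (b : ℝ) (β α : ℕ → ℝ), ∀ θ, Uv P Q θ =
      Rz b * qspProd (fun r => (Ry θ)ᴴ * Rz (α r) * Ry θ * Rz (β r)) d := by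
  induction d with
  | zero =>
    intro P Q h
    obtain ⟨b, hb⟩ := good_zero P Q h
    refine ⟨b, fun _ => 0, fun _ => 0, fun θ => ?_⟩
    rw [qspProd, mul_one, hb]
  | succ d ih =>
    intro P Q h
    obtain ⟨φ1, P1, Q1, g1, e1⟩ := step (2 * d + 1) P Q h (-1) (by norm_num)
    obtain ⟨φ2, P2, Q2, g2, e2⟩ := step (2 * d) P1 Q1 g1 1 (by norm_num)
    obtain ⟨b, β, α, e3⟩ := ih P2 Q2 g2
    refine ⟨φ1, Function.update β (d+1) b, Function.update α (d+1) φ2, fun θ => ?_⟩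
    have key : qspProd (fun r => (Ry θ)ᴴ * Rz (Function.update α (d+1) φ2 r) * Ry θ *
        Rz (Function.update β (d+1) b r)) d =
        qspProd (fun r => (Ry θ)ᴴ * Rz (α r) * Ry θ * Rz (β r)) d := by
      apply qspProd_congr
      intro k _ hk
      rw [Function.update_of_ne (by omega), Function.update_of_ne (by omega)]
    rw [qspProd, key, e1, e2, e3]
    simp only [Function.update_self, RyH_eq, Matrix.mul_assoc]
    simp only [Ry_eq]

/-- nonnegativity on the unit interval -/
def NN (a : ℝ[X]) : Prop := ∀ u ∈ Set.Icc (0 : ℝ) 1, 0 ≤ a.eval u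

/-- Lukács form of degree `d`. -/
def LF (d : ℕ) (a : ℝ[X]) : Prop := ∃ b c : ℝ[X], (∀ k, b.coeff k ≠ 0 → k ≤ d) ∧
  (∀ k, c.coeff k ≠ 0 → k < d) ∧ a = b ^ 2 + X * (1 - X) * c ^ 2

lemma deg_lt_iff (b : ℝ[X]) (d : ℕ) : (∀ k, b.coeff k ≠ 0 → k < d) ↔ degree b < d := by
  rw [degree_lt_iff_coeff_zero]
  constructor
  · intro h m hm; by_contra hc; have := h m hc; omega
  · intro h k hk; by_contra hc; exact hk (h k (by omega))

lemma deg_le_iff' (b : ℝ[X]) (d : ℕ) : (∀ k, b.coeff k ≠ 0 → k ≤ d) ↔ natDegree b ≤ d := by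
  rw [natDegree_le_iff_coeff_eq_zero]
  constructor
  · intro h m hm; by_contra hc; have := h m hc; omega
  · intro h k hk; by_contra hc; exact hk (h k (by omega))

lemma nn_of_mul (q a : ℝ[X]) (h : NN (q * a)) (S : Set ℝ) (hS : S.Finite)
    (hq : ∀ u ∈ Set.Icc (0 : ℝ) 1, u ∉ S → 0 < q.eval u) : NN a := by
  have h1 : ∀ u ∈ Set.Icc (0 : ℝ) 1, u ∉ S → 0 ≤ a.eval u := by
    intro u hu hs
    have := h u hu
    rw [eval_mul] at this
    exact nonneg_of_mul_nonneg_right this (hq u hu hs)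
  have hcl : IsClosed {u : ℝ | 0 ≤ a.eval u} := isClosed_le continuous_const a.continuous
  have hsub : closure (Set.Ioo (0:ℝ) 1 ∩ Sᶜ) ⊆ {u : ℝ | 0 ≤ a.eval u} :=
    hcl.closure_subset_iff.mpr fun u hu => h1 u (Set.Ioo_subset_Icc_self hu.1) hu.2
  have hd : Dense (Sᶜ : Set ℝ) := hS.countable.dense_compl ℝ
  have h2 : Set.Ioo (0:ℝ) 1 ⊆ closure (Set.Ioo (0:ℝ) 1 ∩ Sᶜ) :=
    hd.open_subset_closure_inter isOpen_Ioo
  have h3 := closure_minimal h2 isClosed_closure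
  rw [closure_Ioo (by norm_num)] at h3
  intro u hu
  exact hsub (h3 hu)

lemma factor (a : ℝ[X]) (ha : NN a) (hd : 1 ≤ a.natDegree) :
    ∃ q a', a = q * a' ∧ NN q ∧ NN a' ∧ (q.natDegree = 1 ∨ q.natDegree = 2) := by
  have ha0 : a ≠ 0 := by rintro rfl; simp at hd
  have hdeg : a.degree ≠ 0 := by
    intro h; have := natDegree_eq_zero_iff_degree_le_zero.mpr h.le; omega
  obtain ⟨z, hz⟩ := IsAlgClosed.exists_aeval_eq_zero ℂ a hdeg
  by_cases him : z.im = 0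
  · -- real root
    have hzr : z = ((z.re : ℝ) : ℂ) := by apply Complex.ext <;> simp [him]
    have hr : a.IsRoot z.re := by
      rw [hzr] at hz
      have : aeval (algebraMap ℝ ℂ z.re) a = 0 := hz
      rw [aeval_algebraMap_apply] at this
      simpa [IsRoot, coe_aeval_eq_eval] using this
    generalize z.re = r at hr
    obtain ⟨a1, h1⟩ := dvd_iff_isRoot.mpr hr
    by_cases hr0 : r ≤ 0
    · have hq : ∀ u ∈ Set.Icc (0:ℝ) 1, 0 ≤ (X - C r : ℝ[X]).eval u := by
        intro u hu; simp; linarith [hu.1]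
      refine ⟨X - C r, a1, h1, hq, ?_, Or.inl (natDegree_X_sub_C r)⟩
      refine nn_of_mul (X - C r) a1 (h1 ▸ ha) {r} (Set.finite_singleton r) ?_
      intro u hu hne
      refine lt_of_le_of_ne (hq u hu) ?_
      simp at hne ⊢
      intro h; apply hne; linarith
    by_cases hr1 : 1 ≤ r
    · have hq : ∀ u ∈ Set.Icc (0:ℝ) 1, 0 ≤ (-(X - C r) : ℝ[X]).eval u := by
        intro u hu; simp; linarith [hu.2]
      have h1' : a = -(X - C r) * -a1 := by rw [h1]; ring
      refine ⟨-(X - C r), -a1, h1', hq, ?_, Or.inl (by rw [natDegree_neg]; exact natDegree_X_sub_C r)⟩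
      refine nn_of_mul (-(X - C r)) (-a1) (h1' ▸ ha) {r} (Set.finite_singleton r) ?_
      intro u hu hne
      refine lt_of_le_of_ne (hq u hu) ?_
      simp at hne ⊢
      intro h; apply hne; linarith
    push Not at hr0 hr1
    have hroot : a1.eval r = 0 := by
      have hmin : IsLocalMin (fun u => a.eval u) r := by
        filter_upwards [Icc_mem_nhds hr0 hr1] with u hu
        have h0 : a.eval r = 0 := hr
        rw [h0]; exact ha u hu
      have hder := hmin.deriv_eq_zero
      rw [Polynomial.deriv, h1] at hder
      simpa [derivative_mul] using hder
    obtain ⟨a2, h2⟩ := dvd_iff_isRoot.mpr hroot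
    have h3 : a = (X - C r) ^ 2 * a2 := by rw [h1, h2]; ring
    refine ⟨(X - C r) ^ 2, a2, h3, fun u _ => by simp; positivity, ?_, Or.inr (by simp)⟩
    refine nn_of_mul _ a2 (h3 ▸ ha) {r} (Set.finite_singleton r) ?_
    intro u hu hne
    simp at hne ⊢
    have := sub_ne_zero.mpr hne
    positivity
  · obtain ⟨a', h1⟩ := a.quadratic_dvd_of_aeval_eq_zero_im_ne_zero hz him
    have hq : ∀ u : ℝ, 0 < (X ^ 2 - C (2 * z.re) * X + C (‖z‖ ^ 2) : ℝ[X]).eval u := by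
      intro u
      have : ‖z‖ ^ 2 = z.re * z.re + z.im * z.im := by
        rw [← Complex.normSq_eq_norm_sq, Complex.normSq_apply]
      rw [this]
      simp
      have : 0 < z.im ^ 2 := by positivity
      nlinarith [sq_nonneg (u - z.re)]
    refine ⟨_, a', h1, fun u _ => (hq u).le, ?_, Or.inr ?_⟩
    · exact nn_of_mul _ a' (h1 ▸ ha) ∅ Set.finite_empty fun u _ _ => hq u
    · compute_degree!

lemma quad_LF (q : ℝ[X]) (hq : NN q) (hd : q.natDegree ≤ 2) : LF 1 q := by
  obtain ⟨A, B, D, rfl⟩ : ∃ A B D : ℝ, q = C A * X ^ 2 + C B * X + C D := by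
    refine ⟨q.coeff 2, q.coeff 1, q.coeff 0, ?_⟩
    have := as_sum_range_C_mul_X_pow' (p := q) (n := 3) (by omega)
    conv_lhs => rw [this]
    simp only [Finset.sum_range_succ, Finset.sum_range_zero]
    ring
  have h0 : 0 ≤ D := by simpa using hq 0 (by simp)
  have h1 : 0 ≤ A + B + D := by simpa using hq 1 (by simp)
  set r := Real.sqrt D with hr
  set t := Real.sqrt (A + B + D) with ht
  have hr2 : r ^ 2 = D := Real.sq_sqrt h0
  have ht2 : t ^ 2 = A + B + D := Real.sq_sqrt h1
  have hr0 : 0 ≤ r := Real.sqrt_nonneg _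
  have ht0 : 0 ≤ t := Real.sqrt_nonneg _
  -- coefficient
  have hm : 0 ≤ (B + 2 * D) + 2 * r * t := by
    have hq' : ∀ u : ℝ, 0 ≤ u → u ≤ 1 → 0 ≤ A * u ^ 2 + B * u + D := by
      intro u h0 h1
      simpa using hq u ⟨h0, h1⟩
    set m := B + 2 * D with hm'
    have hq2 : ∀ u : ℝ, 0 ≤ u → u ≤ 1 → 0 ≤ r ^ 2 * (1 - u) ^ 2 + t ^ 2 * u ^ 2 + m * (u * (1 - u)) := by
      intro u h0 h1
      have := hq' u h0 h1
      rw [hr2, ht2, hm']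
      linarith
    rcases hr0.eq_or_lt with h | hrp
    · rw [← h] at hq2 ⊢
      by_contra hneg
      have hm0 : m < 0 := by linarith
      have hden : 0 < 2 * (t ^ 2 - m) := by nlinarith
      set u := -m / (2 * (t ^ 2 - m)) with hu
      have hu0 : 0 < u := div_pos (by linarith) hden
      have hu1 : u ≤ 1 := by rw [hu, div_le_one hden]; nlinarith
      have hue : u * (2 * (t ^ 2 - m)) = -m := div_mul_cancel₀ _ hden.ne'
      have := hq2 u hu0.le hu1
      have h5 : 0 * u = 0 := by ring
      have : 0 ≤ u * (m / 2) := by nlinarith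
      nlinarith
    rcases ht0.eq_or_lt with h | htp
    · rw [← h] at hq2 ⊢
      by_contra hneg
      have hm0 : m < 0 := by linarith
      have hden : 0 < 2 * (r ^ 2 - m) := by nlinarith
      set u := -m / (2 * (r ^ 2 - m)) with hu
      have hu0 : 0 < u := div_pos (by linarith) hden
      have hu1 : u ≤ 1 := by rw [hu, div_le_one hden]; nlinarith
      have hue : u * (2 * (r ^ 2 - m)) = -m := div_mul_cancel₀ _ hden.ne'
      have := hq2 (1 - u) (by linarith) (by linarith)
      have : 0 ≤ u * (m / 2) := by nlinarith
      nlinarith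
    have hs : 0 < r + t := by linarith
    have h6 := hq2 (r / (r + t)) (by positivity) (by rw [div_le_one hs]; linarith)
    have h7 : r ^ 2 * (1 - r / (r + t)) ^ 2 + t ^ 2 * (r / (r + t)) ^ 2 +
        m * (r / (r + t) * (1 - r / (r + t))) = (r * t / (r + t) ^ 2) * (m + 2 * r * t) := by
      field_simp
      ring
    rw [h7] at h6
    exact nonneg_of_mul_nonneg_right h6 (by positivity)
  refine ⟨C r - C (r + t) * X, C (Real.sqrt ((B + 2 * D) + 2 * r * t)), ?_, ?_, ?_⟩
  · rw [deg_le_iff']; compute_degree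
  · rw [deg_lt_iff]; exact degree_C_lt
  · rw [← C_pow, Real.sq_sqrt hm]
    have hrC : (C r : ℝ[X]) ^ 2 = C D := by rw [← C_pow, hr2]
    have htC : (C t : ℝ[X]) ^ 2 = C A + C B + C D := by rw [← C_pow, ht2]; simp
    simp only [C_add, C_mul, C_ofNat]
    linear_combination (-(1 - X)^2) * hrC - X ^ 2 * htC

lemma LF_mul (d : ℕ) (a a' : ℝ[X]) (h : LF 1 a) (h' : LF d a') : LF (d + 1) (a * a') := by
  obtain ⟨b, c, hb, hc, rfl⟩ := h
  obtain ⟨b', c', hb', hc', rfl⟩ := h'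
  rw [deg_le_iff'] at hb hb'
  have hc1 : c.natDegree ≤ 0 := by
    rw [← deg_le_iff']; intro k hk; have := hc k hk; omega
  rcases d with _ | d
  · have hc'0 : c' = 0 := by
      ext k; by_contra hh; have := hc' k hh; omega
    have hb0 : b'.natDegree ≤ 0 := hb'
    refine ⟨b * b', c * b', ?_, ?_, ?_⟩
    · rw [deg_le_iff']
      exact (natDegree_mul_le_of_le hb hb0).trans (by omega)
    · have := (deg_le_iff' (c * b') 0).mpr (natDegree_mul_le_of_le hc1 hb0)
      intro k hk; have := this k hk; omega
    · rw [hc'0]; ring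
  have hc1' : c'.natDegree ≤ d := by
    rw [← deg_le_iff']; intro k hk; have := hc' k hk; omega
  refine ⟨b * b' - X * (1 - X) * (c * c'), b * c' + c * b', ?_, ?_, by ring⟩
  · rw [deg_le_iff']
    have hw : (X * (1 - X) : ℝ[X]).natDegree ≤ 2 := by compute_degree
    refine natDegree_sub_le_of_le (m := d+1+1) (n := d+1+1) ?_ ?_ |>.trans (by simp)
    · exact (natDegree_mul_le_of_le hb hb').trans (by omega)
    · exact (natDegree_mul_le_of_le hw (natDegree_mul_le_of_le hc1 hc1')).trans (by omega)
  · have := (deg_le_iff' (b * c' + c * b') (d+1)).mpr (by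
      refine natDegree_add_le_of_degree_le ?_ ?_
      · exact (natDegree_mul_le_of_le hb hc1').trans (by omega)
      · exact (natDegree_mul_le_of_le hc1 hb').trans (by omega))
    intro k hk; have := this k hk; omega

lemma NN.mul {a b : ℝ[X]} (ha : NN a) (hb : NN b) : NN (a * b) := fun u hu => by
  rw [eval_mul]; exact mul_nonneg (ha u hu) (hb u hu)

lemma lukacs (d : ℕ) : ∀ a : ℝ[X], NN a → a.natDegree ≤ 2 * d → LF d a := by
  induction d with
  | zero =>
    intro a ha hd
    rw [eq_C_of_natDegree_le_zero (by omega : a.natDegree ≤ 0)] at ha ⊢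
    have h0 : 0 ≤ a.coeff 0 := by simpa using ha 0 (by simp)
    refine ⟨C (Real.sqrt (a.coeff 0)), 0, ?_, by simp, ?_⟩
    · rw [deg_le_iff']; simp
    · rw [← C_pow, Real.sq_sqrt h0]; simp
  | succ d ih =>
    intro a ha hd
    suffices h : ∃ q a', a = q * a' ∧ NN q ∧ NN a' ∧ q.natDegree ≤ 2 ∧ a'.natDegree ≤ 2 * d by
      obtain ⟨q, a', rfl, h1, h2, h3, h4⟩ := h
      exact LF_mul d q a' (quad_LF q h1 h3) (ih a' h2 h4)
    by_cases hs : a.natDegree ≤ 2 * d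
    · exact ⟨1, a, by simp, fun u _ => by simp, ha, by simp, hs⟩
    have ha0 : a ≠ 0 := by rintro rfl; simp at hs
    obtain ⟨q, a', rfl, h1, h2, h3⟩ := factor a ha (by omega)
    have hdm := natDegree_mul (left_ne_zero_of_mul ha0) (right_ne_zero_of_mul ha0)
    by_cases hs2 : a'.natDegree ≤ 2 * d
    · exact ⟨q, a', rfl, h1, h2, by omega, hs2⟩
    have ha1 := right_ne_zero_of_mul ha0
    obtain ⟨q', a'', rfl, h1', h2', h3'⟩ := factor a' h2 (by omega)
    have hdm' := natDegree_mul (left_ne_zero_of_mul ha1) (right_ne_zero_of_mul ha1)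
    rcases h3' with h3' | h3'
    · refine ⟨q * q', a'', by ring, h1.mul h1', h2', ?_, by omega⟩
      rw [natDegree_mul (left_ne_zero_of_mul ha0) (left_ne_zero_of_mul ha1)]; omega
    · refine ⟨q', q * a'', by ring, h1', h1.mul h2', by omega, ?_⟩
      rw [natDegree_mul (left_ne_zero_of_mul ha0) (right_ne_zero_of_mul ha1)]; omega
/-- **Achievability of admissible polynomial filters by QSP.** For every real
polynomial `f` of even parity, degree `≤ 2d`, bounded by `1` on `[−1,1]`, there
exist phases `β_0, α_1, β_1, …, α_d, β_d` such that the depth-`d` QSP product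
`M(θ)` satisfies `Re⟨0|M(θ)|0⟩ = f(cos(θ/2))` for all `θ`. -/
theorem qsp_achievability
    (d : ℕ) (hd : 1 ≤ d) (f : Polynomial ℝ)
    (hparity : ∀ x : ℝ, f.eval (-x) = f.eval x)
    (hdeg : f.natDegree ≤ 2 * d)
    (hbound : ∀ x ∈ Set.Icc (-1 : ℝ) 1, |f.eval x| ≤ 1) :
    ∃ β α : ℕ → ℝ,
      ∀ θ : ℝ,
        ((Rz (β 0) *
          qspProd (fun r => (Ry θ)ᴴ * Rz (α r) * Ry θ * Rz (β r)) d) 0 0).re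
          = f.eval (Real.cos (θ / 2)) := by
  classical
  set g := contract 2 f with hg
  have hodd : ∀ k, k % 2 = 1 → f.coeff k = 0 := by
    have hcomp : f.comp (-X) = f := Polynomial.funext fun x => by simp [eval_comp, hparity]
    intro k hk
    have h1 : (f.comp (-X)).coeff k = (-1) ^ k * f.coeff k := by
      rw [show (-X : ℝ[X]) = C (-1) * X by simp, comp_C_mul_X_coeff]; ring
    rw [hcomp, (Nat.odd_iff.mpr hk).neg_one_pow] at h1
    linarith
  have hfg : f = expand ℝ 2 g := by
    ext k
    rw [coeff_expand (by norm_num), hg]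
    split_ifs with h
    · rw [coeff_contract (by norm_num), Nat.div_mul_cancel h]
    · exact hodd k (by omega)
  have hfe : ∀ x, f.eval x = g.eval (x ^ 2) := fun x => by
    conv_lhs => rw [hfg]
    rw [expand_eval]
  have hgd : g.natDegree ≤ d := by
    have := congrArg natDegree hfg
    rw [natDegree_expand] at this
    omega
  have hA : NN (1 - g ^ 2) := by
    intro u hu
    have h1 := hbound (Real.sqrt u) ⟨by linarith [Real.sqrt_nonneg u], Real.sqrt_le_one.mpr hu.2⟩
    rw [hfe, Real.sq_sqrt hu.1] at h1
    have h2 := (sq_le_one_iff_abs_le_one _).mpr h1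
    simp; linarith
  obtain ⟨b, c, hb, hc, hbc⟩ := lukacs d (1 - g ^ 2) hA (by
    refine (natDegree_sub_le_of_le (m := 2 * d) (n := 2 * d) (by simp) ?_).trans (by simp)
    exact natDegree_pow_le_of_le 2 hgd)
  set P : ℂ[X] := f.map Complex.ofRealHom + C Complex.I * (expand ℝ 2 b).map Complex.ofRealHom with hP
  set Q : ℂ[X] := X * (expand ℝ 2 c).map Complex.ofRealHom with hQ
  have hconj : (starRingEnd ℂ).comp Complex.ofRealHom = Complex.ofRealHom := by
    ext x; simp
  have hcP : cj P = f.map Complex.ofRealHom - C Complex.I * (expand ℝ 2 b).map Complex.ofRealHom := by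
    simp only [cj, hP, Polynomial.map_add, Polynomial.map_mul, map_C, Polynomial.map_map, hconj,
      Complex.conj_I, C_neg]
    ring
  have hcQ : cj Q = Q := by
    simp only [cj, hQ, Polynomial.map_mul, map_X, Polynomial.map_map, hconj]
  have hgood : Good (2 * d) P Q := by
    refine ⟨?_, ?_, ?_⟩
    · intro k
      contrapose!
      intro hk
      have h1 : f.coeff k = 0 := by
        by_cases hp : k % 2 = 1
        · exact hodd k hp
        · apply coeff_eq_zero_of_natDegree_lt
          by_contra hh
          exact hk (by omega) (by omega)
      have h2 : (expand ℝ 2 b).coeff k = 0 := by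
        rw [coeff_expand (by norm_num)]
        split_ifs with h
        · by_contra hh
          have := hb _ hh
          exact hk (by omega) (by omega)
        · rfl
      simp only [hP, coeff_add, coeff_C_mul, coeff_map, h1, h2]
      simp
    · intro k
      contrapose!
      intro hk
      rcases k with _ | k
      · simp [hQ]
      · have h2 : (expand ℝ 2 c).coeff k = 0 := by
          rw [coeff_expand (by norm_num)]
          split_ifs with h
          · by_contra hh
            have := hc _ hh
            exact hk (by omega) (by omega)
          · rfl
        simp only [hQ, coeff_X_mul, coeff_map, h2]
        simp
    · rw [hcP, hcQ]
      have h1 := congrArg (fun p => (expand ℝ 2 p).map Complex.ofRealHom) hbc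
      simp only [map_sub, map_add, map_mul, map_pow, map_one, expand_X, ← hfg, Polynomial.map_sub,
        Polynomial.map_add, Polynomial.map_mul, Polynomial.map_pow, Polynomial.map_one, map_X] at h1
      have hI : (C Complex.I : ℂ[X]) * C Complex.I = -1 := by
        rw [← C_mul, Complex.I_mul_I]; simp
      rw [hP, hQ]
      linear_combination (-((expand ℝ 2 b).map Complex.ofRealHom) ^ 2) * hI - h1
  obtain ⟨b0, β, α, hM⟩ := qsp_of_good d P Q hgood
  refine ⟨Function.update β 0 b0, α, fun θ => ?_⟩
  have key : qspProd (fun r => (Ry θ)ᴴ * Rz (α r) * Ry θ *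
      Rz (Function.update β 0 b0 r)) d =
      qspProd (fun r => (Ry θ)ᴴ * Rz (α r) * Ry θ * Rz (β r)) d := by
    apply qspProd_congr
    intro k hk _
    rw [Function.update_of_ne (by omega)]
  rw [key, Function.update_self, ← hM θ]
  have hev : ∀ (p : ℝ[X]) (x : ℝ), (p.map Complex.ofRealHom).eval (x : ℂ) = ((p.eval x : ℝ) : ℂ) := by
    intro p x
    exact Polynomial.eval_map_apply (f := Complex.ofRealHom) (p := p) x
  simp only [Uv, hP, eval_add, eval_mul, eval_C, hev]
  simp
end
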